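/- (Theorem 3.3, first bound, explicit constants.) Let A = M + K with A and M invertible n×n real matrices, b ∈ ℝⁿ with b ≠ 0, x := A⁻¹b, B := I + M⁻¹K, and c := M⁻¹b. Let ε ≥ 0 and suppose x_L ∈ ℝⁿ satisfies ‖c − B·x_L‖ ≤ ε·(‖B‖·‖x_L‖ + 2·‖M⁻¹‖·‖K‖·‖x_L‖) and ‖b − A·x_L‖ ≤ ‖b‖. Then ‖x − x_L‖ ≤ 2ε·κ(B)·(1 + ‖K‖·‖x_L‖/‖b‖)·‖A⁻¹‖·‖b‖. -/

import Mathlib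

open Matrix

/-- Euclidean norm of a vector in `ℝⁿ`. -/
noncomputable def vnorm {n : ℕ} (v : Fin n → ℝ) : ℝ :=
  ‖(WithLp.equiv 2 (Fin n → ℝ)).symm v‖

/-- Operator norm (spectral norm) of a matrix, induced by the Euclidean norm. -/
noncomputable def opnorm {n : ℕ} (A : Matrix (Fin n) (Fin n) ℝ) : ℝ :=
  ‖Matrix.toEuclideanCLM (𝕜 := ℝ) A‖

/-- Condition number `κ(A) = ‖A‖·‖A⁻¹‖` with respect to the spectral norm. -/
noncomputable def condNum {n : ℕ} (A : Matrix (Fin n) (Fin n) ℝ) : ℝ :=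
  opnorm A * opnorm A⁻¹


theorem vnorm_nonneg {n : ℕ} (v : Fin n → ℝ) : 0 ≤ vnorm v :=
  norm_nonneg _

theorem vnorm_pos {n : ℕ} {v : Fin n → ℝ} (hv : v ≠ 0) : 0 < vnorm v := by
  simpa [vnorm] using hv

theorem vnorm_sub_le {n : ℕ} (v w : Fin n → ℝ) : vnorm (v - w) ≤ vnorm v + vnorm w :=
  norm_sub_le (WithLp.toLp 2 v) (WithLp.toLp 2 w)

theorem opnorm_nonneg {n : ℕ} (A : Matrix (Fin n) (Fin n) ℝ) : 0 ≤ opnorm A :=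
  norm_nonneg _

theorem opnorm_mul_le {n : ℕ} (A B : Matrix (Fin n) (Fin n) ℝ) :
    opnorm (A * B) ≤ opnorm A * opnorm B := by
  unfold opnorm
  rw [map_mul]
  exact norm_mul_le _ _

theorem vnorm_mulVec_le {n : ℕ} (A : Matrix (Fin n) (Fin n) ℝ) (v : Fin n → ℝ) :
    vnorm (A.mulVec v) ≤ opnorm A * vnorm v :=
  (Matrix.toEuclideanCLM (𝕜 := ℝ) A).le_opNorm (WithLp.toLp 2 v)

theorem stmt14 {n : ℕ} (M K A : Matrix (Fin n) (Fin n) ℝ)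
    (hM : IsUnit M) (hAdef : A = M + K) (hA : IsUnit A)
    (b : Fin n → ℝ) (hb : b ≠ 0)
    (x : Fin n → ℝ) (hx : x = A⁻¹.mulVec b)
    (B : Matrix (Fin n) (Fin n) ℝ) (hBdef : B = 1 + M⁻¹ * K)
    (c : Fin n → ℝ) (hc : c = M⁻¹.mulVec b)
    (ε : ℝ) (hε : 0 ≤ ε) (xL : Fin n → ℝ)
    (hres : vnorm (c - B.mulVec xL) ≤
      ε * (opnorm B * vnorm xL + 2 * opnorm M⁻¹ * opnorm K * vnorm xL))
    (hres2 : vnorm (b - A.mulVec xL) ≤ vnorm b) :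
    vnorm (x - xL) ≤
      2 * ε * condNum B * (1 + opnorm K * vnorm xL / vnorm b) *
        (opnorm A⁻¹ * vnorm b) := by
  have hMdet := (Matrix.isUnit_iff_isUnit_det M).mp hM
  have hAdet := (Matrix.isUnit_iff_isUnit_det A).mp hA
  have hBA : B = M⁻¹ * A := by
    rw [hBdef, hAdef, mul_add, Matrix.nonsing_inv_mul M hMdet]
  have hBinv : B⁻¹ = A⁻¹ * M := by
    rw [hBA, Matrix.mul_inv_rev, Matrix.nonsing_inv_nonsing_inv M hMdet]
  have hMinv : M⁻¹ = B * A⁻¹ := by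
    rw [hBA, mul_assoc, Matrix.mul_nonsing_inv A hAdet, mul_one]
  have hBB : B⁻¹ * B = 1 := by
    rw [hBinv, hBA, mul_assoc, ← mul_assoc M, Matrix.mul_nonsing_inv M hMdet, one_mul,
      Matrix.nonsing_inv_mul A hAdet]
  have hBM : B⁻¹ * M⁻¹ = A⁻¹ := by
    rw [hBinv, mul_assoc, Matrix.mul_nonsing_inv M hMdet, mul_one]
  have herr : x - xL = B⁻¹.mulVec (c - B.mulVec xL) := by
    rw [Matrix.mulVec_sub, hc, Matrix.mulVec_mulVec, Matrix.mulVec_mulVec, hBB, hBM,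
      Matrix.one_mulVec, hx]
  have hxL : vnorm xL ≤ opnorm A⁻¹ * (2 * vnorm b) := by
    have hAxL : vnorm (A.mulVec xL) ≤ 2 * vnorm b := by
      have h := vnorm_sub_le b (b - A.mulVec xL)
      rw [sub_sub_cancel] at h
      linarith
    calc vnorm xL = vnorm (A⁻¹.mulVec (A.mulVec xL)) := by
          rw [Matrix.mulVec_mulVec, Matrix.nonsing_inv_mul A hAdet, Matrix.one_mulVec]
      _ ≤ opnorm A⁻¹ * vnorm (A.mulVec xL) := vnorm_mulVec_le _ _
      _ ≤ opnorm A⁻¹ * (2 * vnorm b) := mul_le_mul_of_nonneg_left hAxL (opnorm_nonneg _)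
  have hMle : opnorm M⁻¹ ≤ opnorm B * opnorm A⁻¹ := hMinv ▸ opnorm_mul_le B A⁻¹
  have hbpos := vnorm_pos hb
  have := opnorm_nonneg B
  have := opnorm_nonneg B⁻¹
  have := opnorm_nonneg K
  have := vnorm_nonneg xL
  calc vnorm (x - xL) ≤ opnorm B⁻¹ * vnorm (c - B.mulVec xL) :=
        herr ▸ vnorm_mulVec_le _ _
    _ ≤ opnorm B⁻¹ *
        (ε * (opnorm B * vnorm xL + 2 * opnorm M⁻¹ * opnorm K * vnorm xL)) := by gcongr
    _ ≤ opnorm B⁻¹ * (ε * (opnorm B * (opnorm A⁻¹ * (2 * vnorm b)) +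
        2 * (opnorm B * opnorm A⁻¹) * opnorm K * vnorm xL)) := by gcongr
    _ = 2 * ε * condNum B * (1 + opnorm K * vnorm xL / vnorm b) *
        (opnorm A⁻¹ * vnorm b) := by
      unfold condNum
      field_simp
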